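/- For all integers n ≥ 0 and α ≥ 0, p̄_o(3^{2α}(27n+9)) ≡ 0 (mod 3). -/

import Mathlib

/-- Number of overpartitions of `n` into odd parts: pairs consisting of a
partition of some `m ≤ n` into distinct odd parts (the overlined parts)
and a partition of `n - m` into odd parts. -/
def pbarOdd (n : ℕ) : ℕ :=
  ∑ m ∈ Finset.range (n + 1),
    (Nat.Partition.oddDistincts m).card * (Nat.Partition.odds (n - m)).card

open Finset PowerSeries Filter Topology
open scoped PowerSeries.WithPiTopology

theorem sum_neg_one_pow_mul_pow_sq_eq {A : Type*} [CommRing A] (Q : A) (h : ℕ → A)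
    (hh : ∀ s, h s * (1 + Q ^ s) = 1) (n : ℕ) :
    ∑ s ∈ range (n + 1), (-1) ^ s * (∏ i ∈ Ico s n, (1 - Q ^ (i + 1)) * h (i + 1)) *
      Q ^ (s * (n + 1)) * (2 * h s) = 2 * ∑ s ∈ range (n + 1), (-1) ^ s * Q ^ (s ^ 2) - 1 := by
  have h0 : 2 * h 0 = 1 := by linear_combination hh 0
  induction n with
  | zero => simp [h0]; norm_num
  | succ n ih =>
    have telescope : ∀ m ≤ n, ∑ s ∈ range (m + 1),
        ((-1) ^ s * (∏ i ∈ Ico s (n + 1), (1 - Q ^ (i + 1)) * h (i + 1)) *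
          Q ^ (s * (n + 1 + 1)) * (2 * h s) -
        (-1) ^ s * (∏ i ∈ Ico s n, (1 - Q ^ (i + 1)) * h (i + 1)) *
          Q ^ (s * (n + 1)) * (2 * h s)) =
        - (Q ^ (n + 1) * ((-1) ^ m * (∏ i ∈ Ico m n, (1 - Q ^ (i + 1)) * h (i + 1)) *
          Q ^ (m * (n + 1)) * (2 * h (n + 1)))) := by
      intro m
      induction m with
      | zero =>
        intro _
        rw [sum_range_one, prod_Ico_succ_top (Nat.zero_le n)]
        generalize ∏ i ∈ Ico 0 n, (1 - Q ^ (i + 1)) * h (i + 1) = p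
        simp only [pow_zero, zero_mul, one_mul, mul_one]
        linear_combination (p * ((1 - Q ^ (n + 1)) * h (n + 1)) - p) * h0 + p * hh (n + 1)
      | succ m ihm =>
        intro hm
        rw [sum_range_succ, ihm (by omega), prod_Ico_succ_top (by omega : m + 1 ≤ n),
          prod_eq_prod_Ico_succ_bot (by omega : m < n)]
        generalize ∏ i ∈ Ico (m + 1) n, (1 - Q ^ (i + 1)) * h (i + 1) = p
        have e1 : Q ^ ((m + 1) * (n + 1 + 1)) = Q ^ (m * (n + 1)) * Q ^ (n + 1) * Q ^ (m + 1) := by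
          ring
        have e2 : Q ^ ((m + 1) * (n + 1)) = Q ^ (m * (n + 1)) * Q ^ (n + 1) := by ring
        rw [e1, e2, pow_succ (-1 : A) m]
        have hm := hh (m + 1)
        have hn := hh (n + 1)
        generalize Q ^ (n + 1) = y at *
        generalize Q ^ (m + 1) = x at *
        generalize Q ^ (m * (n + 1)) = w at *
        generalize (-1 : A) ^ m = e at *
        linear_combination (2 * e * p * w * y * y * h (n + 1)) * hm -
          2 * e * p * w * y * h (m + 1) * hn
    have := telescope n le_rfl
    rw [sum_sub_distrib, ih] at this
    rw [sum_range_succ, sum_range_succ _ (n + 1), eq_add_of_sub_eq this]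
    simp only [Ico_self, prod_empty]
    have e : Q ^ ((n + 1) ^ 2) = Q ^ (n * (n + 1)) * Q ^ (n + 1) := by ring
    have e1 : Q ^ ((n + 1) * (n + 1 + 1)) = Q ^ (n * (n + 1)) * Q ^ (n + 1) * Q ^ (n + 1) := by ring
    rw [e, e1, pow_succ (-1 : A) n]
    linear_combination (-2 * (-1) ^ n * Q ^ (n * (n + 1)) * Q ^ (n + 1)) * hh (n + 1)

theorem pow_three_eq_expand (f : (ZMod 3)⟦X⟧) : f ^ 3 = expand 3 three_ne_zero f := by
  ext n
  have h1 : coeff n (f ^ 3) = ((trunc (n + 1) f) ^ 3).coeff n := by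
    have := congrArg (Polynomial.coeff · n) (trunc_trunc_pow f (n + 1) 3)
    simpa [coeff_trunc, ← Polynomial.coe_pow] using this.symm
  rw [h1, ← ZMod.expand_card, Polynomial.coeff_expand (by norm_num), coeff_expand]
  split_ifs with h
  · rw [coeff_trunc, if_pos (by omega)]
  · rfl

/-- The weighted theta series `∑ w k * X ^ (d * k ^ 2)`, the sum running over all integers `k`. -/
noncomputable def thetaSeries {R : Type*} [Semiring R] (w : ℤ → R) (d : ℕ) : R⟦X⟧ :=
  PowerSeries.mk fun n => ∑ k ∈ Icc (-n : ℤ) n, if d * k.natAbs ^ 2 = n then w k else 0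

theorem natAbs_le_of_mul_sq_eq {d n : ℕ} (hd : d ≠ 0) {k : ℤ} (h : d * k.natAbs ^ 2 = n) :
    k.natAbs ≤ n := by
  rw [← h]
  calc k.natAbs ≤ k.natAbs ^ 2 := Nat.le_self_pow two_ne_zero _
    _ ≤ d * k.natAbs ^ 2 := Nat.le_mul_of_pos_left _ (Nat.pos_of_ne_zero hd)

theorem coeff_thetaSeries {R : Type*} [Semiring R] (w : ℤ → R) {d : ℕ} (hd : d ≠ 0) {n N : ℕ}
    (h : n ≤ N) : coeff n (thetaSeries w d) =
      ∑ k ∈ Icc (-N : ℤ) N, if d * k.natAbs ^ 2 = n then w k else 0 := by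
  rw [thetaSeries, coeff_mk]
  refine sum_subset (Icc_subset_Icc (by omega) (by omega)) fun k _ hk => if_neg fun hk' => hk ?_
  have := natAbs_le_of_mul_sq_eq hd hk'
  exact mem_Icc.2 (by omega)

theorem coeff_thetaSeries_eq_coeff_sum {R : Type*} [Semiring R] (w : ℤ → R) {d : ℕ} (hd : d ≠ 0)
    {n N : ℕ} (h : n ≤ N) : coeff n (thetaSeries w d) =
      coeff n (∑ k ∈ Icc (-N : ℤ) N, C (w k) * X ^ (d * k.natAbs ^ 2)) := by
  rw [coeff_thetaSeries w hd h, map_sum]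
  refine sum_congr rfl fun k _ => ?_
  simp [coeff_X_pow, eq_comm]

theorem coeff_thetaSeries_mul {R : Type*} [CommSemiring R] (v w : ℤ → R) {d e : ℕ} (hd : d ≠ 0)
    (he : e ≠ 0) {n N : ℕ} (h : n ≤ N) : coeff n (thetaSeries v d * thetaSeries w e) =
      ∑ p ∈ (Icc (-N : ℤ) N ×ˢ Icc (-N : ℤ) N) with
        d * p.1.natAbs ^ 2 + e * p.2.natAbs ^ 2 = n, v p.1 * w p.2 := by
  have : coeff n (thetaSeries v d * thetaSeries w e) =
      coeff n ((∑ k ∈ Icc (-N : ℤ) N, C (v k) * X ^ (d * k.natAbs ^ 2)) *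
        ∑ k ∈ Icc (-N : ℤ) N, C (w k) * X ^ (e * k.natAbs ^ 2)) := by
    rw [coeff_mul, coeff_mul]
    refine sum_congr rfl fun ij hij => ?_
    have := mem_antidiagonal.1 hij
    rw [coeff_thetaSeries_eq_coeff_sum v hd (by omega : ij.1 ≤ N),
      coeff_thetaSeries_eq_coeff_sum w he (by omega : ij.2 ≤ N)]
  rw [this, sum_mul_sum, ← sum_product', map_sum, sum_filter]
  refine sum_congr rfl fun p _ => ?_
  rw [show C (v p.1) * X ^ (d * p.1.natAbs ^ 2) * (C (w p.2) * X ^ (e * p.2.natAbs ^ 2)) =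
    C (v p.1 * w p.2) * X ^ (d * p.1.natAbs ^ 2 + e * p.2.natAbs ^ 2) by
      rw [map_mul, pow_add]; ring]
  rw [coeff_C_mul, coeff_X_pow, mul_ite, mul_one, mul_zero]
  exact if_congr eq_comm rfl rfl

theorem expand_thetaSeries {R : Type*} [CommRing R] (w : ℤ → R) {d e : ℕ} (hd : d ≠ 0)
    (he : e ≠ 0) : expand e he (thetaSeries w d) = thetaSeries w (d * e) := by
  ext n
  rw [coeff_expand]
  split_ifs with h
  · obtain ⟨m, rfl⟩ := h
    rw [Nat.mul_div_cancel_left _ (Nat.pos_of_ne_zero he),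
      coeff_thetaSeries w hd (Nat.le_mul_of_pos_left m (Nat.pos_of_ne_zero he)),
      coeff_thetaSeries w (mul_ne_zero hd he) le_rfl]
    refine sum_congr rfl fun k _ => if_congr ?_ rfl rfl
    rw [mul_comm d e, mul_assoc, mul_right_inj' he]
  · rw [coeff_thetaSeries w (mul_ne_zero hd he) le_rfl]
    refine (sum_eq_zero fun k _ => if_neg fun hk => h ?_).symm
    rw [← hk, mul_comm d e, mul_assoc]
    exact dvd_mul_right _ _

/-- The operator keeping the coefficients with index divisible by three. -/
noncomputable def trisect {R : Type*} [Semiring R] : R⟦X⟧ →+ R⟦X⟧ where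
  toFun f := PowerSeries.mk fun n => coeff (3 * n) f
  map_zero' := by ext; simp
  map_add' _ _ := by ext; simp

theorem coeff_trisect {R : Type*} [Semiring R] (f : R⟦X⟧) (n : ℕ) :
    coeff n (trisect f) = coeff (3 * n) f := by
  simp [trisect]

theorem trisect_expand_add {R : Type*} [CommRing R] (f g h : R⟦X⟧) :
    trisect (expand 3 three_ne_zero f + X * expand 3 three_ne_zero g +
      X ^ 2 * expand 3 three_ne_zero h) = f := by
  ext n
  rw [coeff_trisect, map_add, map_add, coeff_expand_mul, pow_two, mul_assoc]
  cases n with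
  | zero => simp
  | succ n =>
    rw [show 3 * (n + 1) = 3 * n + 1 + 1 + 1 by ring]
    simp only [coeff_succ_X_mul, coeff_expand]
    rw [if_neg (by omega), if_neg (by omega)]
    simp

theorem eq_expand_add {R : Type*} [CommRing R] (f : R⟦X⟧) :
    f = expand 3 three_ne_zero (trisect f) +
      X * expand 3 three_ne_zero (PowerSeries.mk fun n => coeff (3 * n + 1) f) +
      X ^ 2 * expand 3 three_ne_zero (PowerSeries.mk fun n => coeff (3 * n + 2) f) := by
  ext n
  rw [map_add, map_add, pow_two, mul_assoc]
  obtain ⟨m, hm⟩ : ∃ m, n = 3 * m ∨ n = 3 * m + 1 ∨ n = 3 * m + 2 := ⟨n / 3, by omega⟩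
  rcases hm with rfl | rfl | rfl
  · cases m with
    | zero =>
      have := coeff_trisect f 0
      rw [mul_zero, coeff_zero_eq_constantCoeff_apply, coeff_zero_eq_constantCoeff_apply] at this
      simp [this]
    | succ m =>
      rw [show 3 * (m + 1) = 3 * m + 1 + 1 + 1 by ring]
      simp only [coeff_succ_X_mul, coeff_expand]
      rw [if_pos (by omega), if_neg (by omega), if_neg (by omega), coeff_trisect]
      simp only [add_zero]
      congr 2
      omega
  · cases m with
    | zero => simp [coeff_expand]
    | succ m =>
      rw [show 3 * (m + 1) + 1 = 3 * (m + 1) - 1 + 1 + 1 by omega]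
      simp only [coeff_succ_X_mul, coeff_expand]
      rw [if_neg (by omega), if_pos (by omega), if_neg (by omega), coeff_mk]
      simp only [add_zero, zero_add]
      congr 2
      omega
  · simp only [coeff_succ_X_mul, coeff_expand]
    rw [if_neg (by omega), if_neg (by omega), if_pos (by omega), coeff_mk]
    simp only [zero_add]
    congr 2
    omega

theorem trisect_mul_expand {R : Type*} [CommRing R] (f g : R⟦X⟧) :
    trisect (f * expand 3 three_ne_zero g) = trisect f * g := by
  conv_lhs => rw [eq_expand_add f]
  rw [add_mul, add_mul, mul_assoc, mul_assoc, ← map_mul, ← map_mul, ← map_mul, trisect_expand_add]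

theorem coeff_thetaSeries_eq_zero {R : Type*} [Semiring R] (w : ℤ → R) {d n : ℕ}
    (h : ∀ k : ℤ, d * k.natAbs ^ 2 ≠ n) : coeff n (thetaSeries w d) = 0 := by
  rw [thetaSeries, coeff_mk]
  exact sum_eq_zero fun k _ => if_neg (h k)

theorem neg_one_zpow_three_mul (k : ℤ) : (-1 : ZMod 3) ^ (3 * k) = (-1) ^ k := by
  rw [zpow_mul]
  norm_num

theorem trisect_thetaSeries {R : Type*} [CommRing R] {w : ℤ → R} (hw : ∀ k, w (3 * k) = w k)
    {d : ℕ} (hd : ¬ 3 ∣ d) :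
    trisect (thetaSeries w d) = expand 3 three_ne_zero (thetaSeries w d) := by
  have hd0 : d ≠ 0 := by rintro rfl; exact hd (dvd_zero 3)
  have hd3 : d * 3 ≠ 0 := by omega
  ext n
  rw [expand_thetaSeries w hd0 three_ne_zero, coeff_trisect, coeff_thetaSeries w hd0 le_rfl,
    coeff_thetaSeries w hd3 (by omega : n ≤ 3 * n), ← sum_filter, ← sum_filter]
  symm
  refine sum_bij (fun k _ => 3 * k) (fun k hk => ?_) (fun k _ l _ h => ?_) (fun l hl => ?_)
    fun k _ => (hw k).symm
  · have h := (mem_filter.1 hk).2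
    have h' : d * (3 * k).natAbs ^ 2 = 3 * n := by
      rw [← h, Int.natAbs_mul, show (3 : ℤ).natAbs = 3 from rfl]; ring
    have := natAbs_le_of_mul_sq_eq hd0 h'
    exact mem_filter.2 ⟨mem_Icc.2 (by omega), h'⟩
  · omega
  · have h := (mem_filter.1 hl).2
    have h3 : 3 ∣ d * l.natAbs ^ 2 := ⟨n, h⟩
    have hl3 : 3 ∣ l.natAbs :=
      Nat.prime_three.dvd_of_dvd_pow ((Nat.prime_three.dvd_mul.1 h3).resolve_left hd)
    obtain ⟨k, rfl⟩ := Int.natCast_dvd.2 hl3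
    have h' : d * 3 * k.natAbs ^ 2 = n := by
      have : d * (3 * k.natAbs) ^ 2 = 3 * n := by
        rw [← h, Int.natAbs_mul]; rfl
      nlinarith
    have := natAbs_le_of_mul_sq_eq hd3 h'
    exact ⟨k, mem_filter.2 ⟨mem_Icc.2 (by omega), h'⟩, rfl⟩

/-- The integral points in a box which solve `x ^ 2 + 2 * y ^ 2 = n`. -/
noncomputable def sqAddTwoSqSols (N : ℕ) (n : ℕ) : Finset (ℤ × ℤ) :=
  {p ∈ Icc (-N : ℤ) N ×ˢ Icc (-N : ℤ) N | p.1 ^ 2 + 2 * p.2 ^ 2 = n}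

theorem mem_sqAddTwoSqSols {N n : ℕ} (h : n ≤ N) {p : ℤ × ℤ} :
    p ∈ sqAddTwoSqSols N n ↔ p.1 ^ 2 + 2 * p.2 ^ 2 = n := by
  rw [sqAddTwoSqSols, mem_filter, mem_product, mem_Icc, mem_Icc, and_iff_right_iff_imp]
  intro hp
  have h' : (n : ℤ) ≤ N := by exact_mod_cast h
  refine ⟨⟨?_, ?_⟩, ?_, ?_⟩ <;> nlinarith [sq_nonneg p.1, sq_nonneg p.2, Int.le_self_sq p.1,
    Int.le_self_sq p.2, Int.le_self_sq (-p.1), Int.le_self_sq (-p.2)]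

theorem coeff_thetaSeries_mul_two {R : Type*} [CommSemiring R] (v w : ℤ → R) {n N : ℕ}
    (h : n ≤ N) : coeff n (thetaSeries v 1 * thetaSeries w 2) =
      ∑ p ∈ sqAddTwoSqSols N n, v p.1 * w p.2 := by
  rw [coeff_thetaSeries_mul v w one_ne_zero two_ne_zero h, sqAddTwoSqSols]
  refine sum_congr (filter_congr fun p _ => ?_) fun _ _ => rfl
  rw [← Nat.cast_inj (R := ℤ)]
  simp

theorem sum_sqAddTwoSqSols_three_dvd_sub (n : ℕ) :
    ∑ p ∈ sqAddTwoSqSols (3 * n) (3 * n) with 3 ∣ p.2 - p.1, (-1 : ZMod 3) ^ p.1 * (-1) ^ p.2 =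
      ∑ p ∈ sqAddTwoSqSols n n, 1 * (-1 : ZMod 3) ^ p.2 := by
  symm
  refine sum_bij (fun p _ => (p.1 - 2 * p.2, p.1 + p.2)) (fun p hp => ?_) (fun p _ q _ h => ?_)
    (fun q hq => ?_) fun p _ => ?_
  · rw [mem_sqAddTwoSqSols le_rfl] at hp
    rw [mem_filter, mem_sqAddTwoSqSols le_rfl]
    push_cast
    exact ⟨by linear_combination 3 * hp, ⟨p.2, by ring⟩⟩
  · rw [Prod.mk.injEq] at h
    ext <;> omega
  · rw [mem_filter, mem_sqAddTwoSqSols le_rfl] at hq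
    obtain ⟨h, m, hm⟩ := hq
    refine ⟨(q.1 + 2 * m, m), ?_, by ext <;> simp only <;> omega⟩
    rw [mem_sqAddTwoSqSols le_rfl]
    rw [show q.2 = q.1 + 3 * m by omega] at h
    push_cast at h
    linarith
  · rw [← zpow_add₀ (by decide), one_mul, show p.1 - 2 * p.2 + (p.1 + p.2) = 2 * (p.1 - p.2) + p.2
      by ring, zpow_add₀ (by decide), (even_two_mul _).neg_one_zpow, one_mul]

theorem sum_sqAddTwoSqSols_three_dvd_add (n : ℕ) :
    ∑ p ∈ sqAddTwoSqSols (3 * n) (3 * n) with 3 ∣ p.2 + p.1, (-1 : ZMod 3) ^ p.1 * (-1) ^ p.2 =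
      ∑ p ∈ sqAddTwoSqSols (3 * n) (3 * n) with 3 ∣ p.2 - p.1,
        (-1 : ZMod 3) ^ p.1 * (-1) ^ p.2 := by
  refine sum_nbij' (fun p => (-p.1, p.2)) (fun p => (-p.1, p.2)) ?_ ?_ (by simp) (by simp) ?_ <;>
    intro p hp
  · rw [mem_filter, mem_sqAddTwoSqSols le_rfl] at hp ⊢
    simpa using hp
  · rw [mem_filter, mem_sqAddTwoSqSols le_rfl] at hp ⊢
    simpa [sub_eq_add_neg] using hp
  · simp [zpow_neg, ← inv_zpow]

theorem sum_sqAddTwoSqSols_three_dvd_and (n : ℕ) :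
    ∑ p ∈ sqAddTwoSqSols (3 * n) (3 * n) with 3 ∣ p.2 + p.1 ∧ 3 ∣ p.2 - p.1,
        (-1 : ZMod 3) ^ p.1 * (-1) ^ p.2 =
      coeff n (expand 3 three_ne_zero (thetaSeries (fun k => (-1 : ZMod 3) ^ k) 1 *
        thetaSeries (fun k => (-1 : ZMod 3) ^ k) 2)) := by
  rw [coeff_expand]
  split_ifs with hn
  · obtain ⟨m, rfl⟩ := hn
    rw [Nat.mul_div_cancel_left _ (by norm_num), coeff_thetaSeries_mul_two _ _ le_rfl]
    symm
    refine sum_bij (fun p _ => (3 * p.1, 3 * p.2)) (fun p hp => ?_) (fun p _ q _ h => ?_)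
      (fun q hq => ?_) fun p _ => ?_
    · rw [mem_sqAddTwoSqSols le_rfl] at hp
      rw [mem_filter, mem_sqAddTwoSqSols le_rfl]
      push_cast
      exact ⟨by linear_combination 9 * hp, by omega, by omega⟩
    · rw [Prod.mk.injEq] at h
      ext <;> omega
    · rw [mem_filter, mem_sqAddTwoSqSols le_rfl] at hq
      obtain ⟨h, h1, h2⟩ := hq
      obtain ⟨⟨k, hk⟩, l, hl⟩ : 3 ∣ q.1 ∧ 3 ∣ q.2 := by omega
      refine ⟨(k, l), ?_, by ext <;> simp only <;> omega⟩
      rw [mem_sqAddTwoSqSols le_rfl]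
      rw [hk, hl] at h
      push_cast at h
      linarith
    · simp only [neg_one_zpow_three_mul]
  · refine sum_eq_zero fun q hq => (hn ?_).elim
    rw [mem_filter, mem_sqAddTwoSqSols le_rfl] at hq
    obtain ⟨h, h1, h2⟩ := hq
    obtain ⟨⟨k, hk⟩, l, hl⟩ : 3 ∣ q.1 ∧ 3 ∣ q.2 := by omega
    rw [hk, hl] at h
    push_cast at h
    have : (3 : ℤ) ∣ n := ⟨k ^ 2 + 2 * l ^ 2, by linarith⟩
    exact_mod_cast this

theorem trisect_thetaSeries_mul_two :
    trisect (thetaSeries (fun k => (-1 : ZMod 3) ^ k) 1 * thetaSeries (fun k => (-1) ^ k) 2) =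
      2 * (thetaSeries (fun _ => 1) 1 * thetaSeries (fun k => (-1) ^ k) 2) -
        expand 3 three_ne_zero (thetaSeries (fun k => (-1 : ZMod 3) ^ k) 1 *
          thetaSeries (fun k => (-1) ^ k) 2) := by
  ext n
  rw [map_sub, coeff_trisect, coeff_thetaSeries_mul_two _ _ le_rfl, two_mul, map_add,
    coeff_thetaSeries_mul_two _ _ le_rfl, eq_sub_iff_add_eq, ← sum_sqAddTwoSqSols_three_dvd_and,
    ← sum_sqAddTwoSqSols_three_dvd_sub]
  refine Eq.trans ?_ (congrArg (· + _) (sum_sqAddTwoSqSols_three_dvd_add n))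
  conv_rhs => rw [← sum_union_inter, ← filter_or, ← filter_and]
  congr 1
  refine sum_congr (filter_true_of_mem fun p hp => ?_).symm fun _ _ => rfl
  rw [mem_sqAddTwoSqSols le_rfl] at hp
  push_cast at hp
  exact Int.prime_three.dvd_or_dvd ⟨p.2 ^ 2 - n, by linear_combination -hp⟩

theorem tendsto_thetaSeries {R : Type*} [CommRing R] [TopologicalSpace R] {w : ℤ → R} {d : ℕ}
    (hd : d ≠ 0) {u : ℕ → R⟦X⟧} (hu : ∀ n : ℕ, X ^ (n + 1) ∣
      (∑ k ∈ Icc (-n : ℤ) n, C (w k) * X ^ (d * k.natAbs ^ 2)) - u n) :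
    Tendsto u atTop (𝓝 (thetaSeries w d)) := by
  rw [WithPiTopology.tendsto_iff_coeff_tendsto]
  intro n
  refine tendsto_const_nhds.congr' ?_
  filter_upwards [eventually_ge_atTop n] with N hN
  rw [coeff_thetaSeries_eq_coeff_sum w hd hN, ← sub_eq_zero, ← map_sub]
  exact X_pow_dvd_iff.1 (hu N) n (by omega)

theorem sum_Icc_eq_two_mul_sum_range {R : Type*} [CommRing R] {w : ℤ → R} {d : ℕ} {c : R}
    (hw : ∀ k, w k = (-1) ^ k.natAbs * c ^ k.natAbs ^ 2) (n : ℕ) :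
    ∑ k ∈ Icc (-n : ℤ) n, C (w k) * X ^ (d * k.natAbs ^ 2) =
      2 * ∑ s ∈ range (n + 1), (-1) ^ s * (C c * X ^ d) ^ (s ^ 2) - 1 := by
  rw [sum_Icc_of_even_eq_range fun k => by simp [hw], nsmul_eq_mul]
  congr 2
  · refine sum_congr rfl fun s _ => ?_
    simp [hw, mul_pow, pow_mul, mul_assoc]
  · simp [hw]

/-- Gauss's product expansion of theta series. -/
theorem tendsto_prod_thetaSeries {F : Type*} [Field F] [TopologicalSpace F]
    (h2 : (2 : F) ≠ 0) {w : ℤ → F} {d : ℕ} (hd : d ≠ 0) {c : F}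
    (hw : ∀ k, w k = (-1) ^ k.natAbs * c ^ k.natAbs ^ 2) :
    Tendsto (fun n : ℕ => ∏ i ∈ range n,
      ((1 - (C c * X ^ d) ^ (i + 1)) * (1 + (C c * X ^ d) ^ (i + 1))⁻¹)) atTop
      (𝓝 (thetaSeries w d)) := by
  have hQ : X ∣ C c * (X : F⟦X⟧) ^ d := (dvd_pow_self X hd).mul_left _
  have hinv (s : ℕ) : (1 + (C c * (X : F⟦X⟧) ^ d) ^ s)⁻¹ * (1 + (C c * X ^ d) ^ s) = 1 :=
    PowerSeries.inv_mul_cancel _ <| by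
      cases s with
      | zero => rwa [pow_zero, one_add_one_eq_two, map_ofNat]
      | succ s => simp [hd]
  refine tendsto_thetaSeries hd fun n => ?_
  rw [sum_Icc_eq_two_mul_sum_range hw, ← sum_neg_one_pow_mul_pow_sq_eq _
    (fun s => (1 + (C c * X ^ d) ^ s)⁻¹) hinv, sum_range_succ', Nat.Ico_zero_eq_range,
    show 2 * (1 + (C c * (X : F⟦X⟧) ^ d) ^ 0)⁻¹ = 1 by linear_combination hinv 0,
    pow_zero, one_mul, zero_mul, pow_zero, mul_one, mul_one, add_sub_cancel_right]
  refine dvd_sum fun s _ => ((?_ : X ^ (n + 1) ∣ _).mul_left _).mul_right _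
  exact (pow_dvd_pow_of_dvd hQ _).trans (pow_dvd_pow _ (Nat.le_mul_of_pos_left _ s.succ_pos))

theorem hasProd_card_oddDistincts (R : Type*) [CommSemiring R] [TopologicalSpace R] [T2Space R] :
    HasProd (fun i => if ¬ Even (i + 1) then 1 + X ^ (i + 1) else 1)
      (PowerSeries.mk fun n => ((Nat.Partition.oddDistincts n).card : R)) := by
  convert! Nat.Partition.hasProd_genFun
    (fun i c => if ¬ Even i ∧ c ≤ 1 then (1 : R) else 0) using 1
  · ext1 i
    rw [tsum_eq_single 0 fun j hj => by simp [hj]]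
    split_ifs with h <;> simp_all
  · ext n
    rw [coeff_mk, Nat.Partition.coeff_genFun, Nat.Partition.oddDistincts, Nat.Partition.odds,
      Nat.Partition.restricted, Nat.Partition.distincts, ← filter_and, card_filter]
    simp only [Finsupp.prod, prod_boole, Nat.cast_sum, Nat.cast_ite, Nat.cast_one, Nat.cast_zero]
    refine sum_congr rfl fun p _ => if_congr ?_ rfl rfl
    rw [Multiset.nodup_iff_count_le_one]
    simp only [Multiset.toFinsupp_support, Multiset.mem_toFinset, Multiset.toFinsupp_apply]
    constructor
    · exact fun h i hi => ⟨h.1 i hi, h.2 i⟩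
    · refine fun h => ⟨fun i hi => (h i hi).1, fun i => ?_⟩
      by_cases hi : i ∈ p.parts
      · exact (h i hi).2
      · simp [Multiset.count_eq_zero_of_notMem hi]

theorem hasProd_pbarOdd (F : Type*) [Field F] [TopologicalSpace F] [IsTopologicalRing F]
    [T2Space F] :
    HasProd (fun i => if ¬ Even (i + 1) then (1 + X ^ (i + 1)) * (1 - X ^ (i + 1))⁻¹ else 1)
      (PowerSeries.mk fun n => (pbarOdd n : F)) := by
  convert! (hasProd_card_oddDistincts F).mul
    (Nat.Partition.hasProd_powerSeriesMk_card_restricted F (¬ Even ·)) using 1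
  · ext1 i
    split_ifs with h
    · rw [mul_one]
    · congr 1
      have := WithPiTopology.tsum_pow_mul_one_sub_of_constantCoeff_eq_zero
        (f := (X : F⟦X⟧) ^ (i + 1)) (by simp)
      simp_rw [pow_mul]
      rw [PowerSeries.inv_eq_iff_mul_eq_one (by simp), this]
  · ext n
    rw [coeff_mk, coeff_mul, Nat.sum_antidiagonal_eq_sum_range_succ_mk, pbarOdd]
    simp [Nat.Partition.odds]

theorem one_add_X_pow_inv_mul (F : Type*) [Field F] (n : ℕ) :
    (1 + (X : F⟦X⟧) ^ (n + 1))⁻¹ * (1 + X ^ (n + 1)) = 1 :=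
  PowerSeries.inv_mul_cancel _ (by simp)

theorem one_sub_X_pow_inv_mul (F : Type*) [Field F] (n : ℕ) :
    (1 - (X : F⟦X⟧) ^ (n + 1))⁻¹ * (1 - X ^ (n + 1)) = 1 :=
  PowerSeries.inv_mul_cancel _ (by simp)

theorem mk_pbarOdd_mul_thetaSeries {F : Type*} [Field F] (h2 : (2 : F) ≠ 0) :
    (PowerSeries.mk fun n => (pbarOdd n : F)) * thetaSeries (fun k => (-1) ^ k.natAbs) 1 =
      thetaSeries (fun k => (-1) ^ k.natAbs) 2 := by
  let _ : TopologicalSpace F := ⊥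
  have _ : DiscreteTopology F := ⟨rfl⟩
  have htwo : Tendsto (fun n : ℕ => 2 * n) atTop atTop :=
    tendsto_id.const_mul_atTop' two_pos
  refine tendsto_nhds_unique (((hasProd_pbarOdd F).tendsto_prod_nat.mul
    (tendsto_prod_thetaSeries h2 one_ne_zero (c := 1) fun k => by simp)).comp htwo)
    ((tendsto_prod_thetaSeries h2 two_ne_zero (c := 1) fun k => by simp).congr fun n => ?_)
  simp only [map_one, one_mul, pow_one, Function.comp]
  induction n with
  | zero => simp
  | succ n ih =>
    rw [prod_range_succ, ih, mul_add, mul_one, prod_range_succ, prod_range_succ, prod_range_succ,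
      prod_range_succ, if_pos (by simp [parity_simps]), if_neg (by simp [parity_simps])]
    have e : ((X : F⟦X⟧) ^ 2) ^ (n + 1) = X ^ (2 * n + 1 + 1) := by ring
    rw [e]
    generalize (∏ i ∈ range (2 * n), if ¬ Even (i + 1) then
      (1 + (X : F⟦X⟧) ^ (i + 1)) * (1 - X ^ (i + 1))⁻¹ else 1) = p
    generalize ∏ i ∈ range (2 * n), ((1 - (X : F⟦X⟧) ^ (i + 1)) * (1 + X ^ (i + 1))⁻¹) = g
    generalize (1 - (X : F⟦X⟧) ^ (2 * n + 1 + 1)) * (1 + X ^ (2 * n + 1 + 1))⁻¹ = t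
    linear_combination (-p * g * t) * one_add_X_pow_inv_mul F (2 * n) - p * g * t *
      ((1 + X ^ (2 * n + 1))⁻¹ * (1 + X ^ (2 * n + 1))) * one_sub_X_pow_inv_mul F (2 * n)

theorem thetaSeries_mul_thetaSeries {F : Type*} [Field F] (h2 : (2 : F) ≠ 0) :
    thetaSeries (fun k : ℤ => (-1 : F) ^ k.natAbs) 1 * thetaSeries (fun _ => 1) 1 =
      thetaSeries (fun k => (-1) ^ k.natAbs) 2 ^ 2 := by
  let _ : TopologicalSpace F := ⊥
  have _ : DiscreteTopology F := ⟨rfl⟩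
  have htwo : Tendsto (fun n : ℕ => 2 * n) atTop atTop :=
    tendsto_id.const_mul_atTop' two_pos
  refine tendsto_nhds_unique
    (((tendsto_prod_thetaSeries h2 one_ne_zero (c := 1) fun k => by simp).mul
    (tendsto_prod_thetaSeries h2 one_ne_zero (c := -1) fun k => ?_)).comp htwo)
    (((tendsto_prod_thetaSeries h2 two_ne_zero (c := 1) fun k => by simp).pow 2).congr fun n => ?_)
  · rw [← pow_add, Even.neg_one_pow]
    simp [parity_simps]
  simp only [map_one, one_mul, pow_one, Function.comp, map_neg]
  induction n with
  | zero => simp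
  | succ n ih =>
    rw [prod_range_succ, mul_pow, ih, mul_add, mul_one, prod_range_succ, prod_range_succ,
      prod_range_succ, prod_range_succ]
    have e : ((X : F⟦X⟧) ^ 2) ^ (n + 1) = X ^ (2 * n + 1 + 1) := by ring
    have e1 : (-1 * (X : F⟦X⟧)) ^ (2 * n + 1) = - X ^ (2 * n + 1) := by
      rw [neg_one_mul, Odd.neg_pow (by simp [parity_simps])]
    have e2 : (-1 * (X : F⟦X⟧)) ^ (2 * n + 1 + 1) = X ^ (2 * n + 1 + 1) := by
      rw [neg_one_mul, Even.neg_pow (by simp [parity_simps])]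
    rw [e, e1, e2, sub_neg_eq_add, ← sub_eq_add_neg]
    generalize ∏ i ∈ range (2 * n), ((1 - (-1 * (X : F⟦X⟧)) ^ (i + 1)) *
      (1 + (-1 * X) ^ (i + 1))⁻¹) = p
    generalize ∏ i ∈ range (2 * n), ((1 - (X : F⟦X⟧) ^ (i + 1)) * (1 + X ^ (i + 1))⁻¹) = g
    generalize (1 - (X : F⟦X⟧) ^ (2 * n + 1 + 1)) * (1 + X ^ (2 * n + 1 + 1))⁻¹ = t
    linear_combination (-p * g * t ^ 2) * one_add_X_pow_inv_mul F (2 * n) - p * g * t ^ 2 *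
      ((1 + X ^ (2 * n + 1))⁻¹ * (1 + X ^ (2 * n + 1))) * one_sub_X_pow_inv_mul F (2 * n)

theorem neg_one_zpow_eq_pow_natAbs {F : Type*} [DivisionRing F] (k : ℤ) :
    (-1 : F) ^ k = (-1) ^ k.natAbs := by
  obtain h | h := Int.even_or_odd k
  · rw [h.neg_one_zpow, (Int.natAbs_even.2 h).neg_one_pow]
  · rw [h.neg_one_zpow, (Int.natAbs_odd.2 h).neg_one_pow]

/-- The theta series `∑ (-1) ^ k * X ^ (d * k ^ 2)` modulo three. -/
noncomputable def altTheta (d : ℕ) : (ZMod 3)⟦X⟧ :=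
  thetaSeries (fun k => (-1) ^ k) d

/-- The generating function of `pbarOdd` modulo three. -/
noncomputable def pbarOddSeries : (ZMod 3)⟦X⟧ :=
  PowerSeries.mk fun n => (pbarOdd n : ZMod 3)

theorem three_eq_zero_zmod_three : (3 : (ZMod 3)⟦X⟧) = 0 := by
  rw [← map_ofNat (C (R := ZMod 3)), show (OfNat.ofNat 3 : ZMod 3) = 0 by decide, map_zero]

theorem pbarOddSeries_mul_altTheta_one : pbarOddSeries * altTheta 1 = altTheta 2 := by
  simpa only [altTheta, pbarOddSeries, neg_one_zpow_eq_pow_natAbs] using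
    mk_pbarOdd_mul_thetaSeries (F := ZMod 3) (by decide)

theorem altTheta_one_mul_thetaSeries_one :
    altTheta 1 * thetaSeries (fun _ => 1) 1 = altTheta 2 ^ 2 := by
  simpa only [altTheta, neg_one_zpow_eq_pow_natAbs] using
    thetaSeries_mul_thetaSeries (F := ZMod 3) (by decide)

theorem trisect_altTheta {d : ℕ} (hd : ¬ 3 ∣ d) : trisect (altTheta d) = altTheta d ^ 3 := by
  rw [altTheta, trisect_thetaSeries neg_one_zpow_three_mul hd, pow_three_eq_expand]

theorem altTheta_one_eq : ∃ f, altTheta 1 =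
    expand 3 three_ne_zero (altTheta 1 ^ 3) + X * expand 3 three_ne_zero f := by
  have h : (PowerSeries.mk fun n => coeff (3 * n + 2) (altTheta 1)) = 0 := by
    ext n
    refine (coeff_mk _ _).trans (coeff_thetaSeries_eq_zero _ fun k hk => ?_)
    have := Nat.pow_mod k.natAbs 2 3
    have hk3 := Nat.mod_lt k.natAbs three_pos
    interval_cases k.natAbs % 3 <;> omega
  have := eq_expand_add (altTheta 1)
  rw [trisect_altTheta (by norm_num), h, map_zero, mul_zero, add_zero] at this
  exact ⟨_, this⟩

theorem altTheta_two_eq : ∃ f, altTheta 2 =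
    expand 3 three_ne_zero (altTheta 2 ^ 3) + X ^ 2 * expand 3 three_ne_zero f := by
  have h : (PowerSeries.mk fun n => coeff (3 * n + 1) (altTheta 2)) = 0 := by
    ext n
    refine (coeff_mk _ _).trans (coeff_thetaSeries_eq_zero _ fun k hk => ?_)
    have := Nat.pow_mod k.natAbs 2 3
    have hk3 := Nat.mod_lt k.natAbs three_pos
    interval_cases k.natAbs % 3 <;> omega
  have := eq_expand_add (altTheta 2)
  rw [trisect_altTheta (by norm_num), h, map_zero, mul_zero, add_zero] at this
  exact ⟨_, this⟩

theorem trisect_altTheta_mul_altTheta :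
    trisect (altTheta 1 * altTheta 2) =
      - (thetaSeries (fun _ => 1) 1 * altTheta 2) - (altTheta 1 * altTheta 2) ^ 3 := by
  rw [altTheta, altTheta, trisect_thetaSeries_mul_two, pow_three_eq_expand]
  linear_combination (thetaSeries (fun _ => (1 : ZMod 3)) 1 * thetaSeries (fun k => (-1) ^ k) 2) *
    three_eq_zero_zmod_three

theorem altTheta_one_ne_zero : altTheta 1 ≠ 0 := by
  intro h
  have := congrArg (coeff 0) h
  simp [altTheta, thetaSeries] at this

theorem trisect_pbarOddSeries : trisect pbarOddSeries = altTheta 1 * altTheta 2 ^ 3 := by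
  obtain ⟨f, hf⟩ := altTheta_one_eq
  obtain ⟨g, hg⟩ := altTheta_two_eq
  have hP := pbarOddSeries_mul_altTheta_one
  have h3 := trisect_altTheta_mul_altTheta
  have h6 := altTheta_one_mul_thetaSeries_one
  have ha := altTheta_one_ne_zero
  set a := altTheta 1
  set b := altTheta 2
  have h1 : trisect (a * b) = a ^ 3 * b ^ 3 + X * f * g := by
    rw [← trisect_expand_add (a ^ 3 * b ^ 3 + X * f * g) (b ^ 3 * f) (a ^ 3 * g)]
    congr 1
    conv_lhs => rw [hf, hg]
    simp only [map_add, map_mul, expand_X]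
    ring
  have h2 : trisect (a ^ 2 * b) = a ^ 3 * (a ^ 3 * b ^ 3 + 2 * X * f * g) := by
    rw [← trisect_expand_add (a ^ 3 * (a ^ 3 * b ^ 3 + 2 * X * f * g))
      (2 * a ^ 3 * f * b ^ 3 + X * f ^ 2 * g) (f ^ 2 * b ^ 3 + a ^ 6 * g)]
    congr 1
    conv_lhs => rw [hf, hg]
    simp only [map_add, map_mul, map_pow, expand_X, map_ofNat]
    ring
  have h4 : trisect pbarOddSeries * a = trisect (a ^ 2 * b) := by
    rw [← trisect_mul_expand, ← pow_three_eq_expand]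
    congr 1
    linear_combination a ^ 2 * hP
  rw [h1] at h3
  apply mul_right_cancel₀ ha
  rw [h4, h2]
  linear_combination 2 * a ^ 3 * h3 - 2 * a ^ 2 * b * h6 -
    (a ^ 6 * b ^ 3 + a ^ 2 * b ^ 3) * three_eq_zero_zmod_three

theorem trisect_trisect_pbarOddSeries :
    trisect (trisect pbarOddSeries) = altTheta 1 ^ 3 * altTheta 2 := by
  rw [trisect_pbarOddSeries, pow_three_eq_expand (altTheta 2), trisect_mul_expand,
    trisect_altTheta (by norm_num)]

theorem trisect_iterate_pbarOddSeries (α : ℕ) :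
    trisect^[2 * α + 2] pbarOddSeries = altTheta 1 ^ 3 * altTheta 2 := by
  induction α with
  | zero => exact trisect_trisect_pbarOddSeries
  | succ α ih =>
    have h : trisect (altTheta 1 ^ 3 * altTheta 2) = altTheta 1 * altTheta 2 ^ 3 := by
      rw [mul_comm, pow_three_eq_expand (altTheta 1), trisect_mul_expand,
        trisect_altTheta (by norm_num), mul_comm]
    rw [show 2 * (α + 1) + 2 = 2 * α + 2 + 1 + 1 by ring, Function.iterate_succ_apply',
      Function.iterate_succ_apply', ih, h, ← trisect_pbarOddSeries, trisect_trisect_pbarOddSeries]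

theorem coeff_trisect_iterate {R : Type*} [Semiring R] (f : R⟦X⟧) (k n : ℕ) :
    coeff n (trisect^[k] f) = coeff (3 ^ k * n) f := by
  induction k generalizing n with
  | zero => simp
  | succ k ih => rw [Function.iterate_succ_apply', coeff_trisect, ih, pow_succ, mul_assoc]

theorem pbarOdd_cong_27_9 (n α : ℕ) :
    pbarOdd (3 ^ (2 * α) * (27 * n + 9)) ≡ 0 [MOD 3] := by
  have h := coeff_trisect_iterate pbarOddSeries (2 * α + 2) (3 * n + 1)
  obtain ⟨g, hg⟩ := altTheta_two_eq
  rw [show 3 ^ (2 * α + 2) * (3 * n + 1) = 3 ^ (2 * α) * (27 * n + 9) by ring,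
    trisect_iterate_pbarOddSeries, hg, pow_three_eq_expand, mul_add, mul_left_comm, ← map_mul,
    ← map_mul, map_add, coeff_expand_of_not_dvd _ _ _ (by omega), pbarOddSeries, coeff_mk,
    zero_add] at h
  rw [← ZMod.natCast_eq_natCast_iff, ← h, Nat.cast_zero]
  cases n with
  | zero => simp [coeff_X_pow_mul']
  | succ n => rw [coeff_X_pow_mul', if_pos (by omega), coeff_expand_of_not_dvd _ _ _ (by omega)]
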